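/- arXiv:2004.08015 — 2 statements merged into one kernel-verified Lean document; each statement's English description precedes it below -/
import Mathlib

section
/- Support equality propagates to all extensions: let P be a generalized itemset, a a literal not occurring in P, and D a finite set of tuples with Sup_D(P) = Sup_D(P + a). Then for every generalized itemset Z with P + a ⊆ Z, one has Occ_D(Z \ {a}) = Occ_D(Z), and in particular Sup_D(Z \ {a}) = Sup_D(Z), where Z \ {a} denotes Z with the literal a removed. -/
/-- A generalized itemset (pattern) over an item alphabet `I`:
a set of positive literals and a set of negated items. -/
structure Pattern (I : Type*) where
  pos : Finset I
  neg : Finset I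

variable {I : Type*} [Fintype I] [DecidableEq I]

/-- `X` occurs in tuple `t` (`X ⊑ t`): every item of `X.pos` is in `t`
and no item of `X.neg` is in `t`. -/
def occursIn (X : Pattern I) (t : Finset I) : Prop :=
  (∀ x ∈ X.pos, x ∈ t) ∧ (∀ x ∈ X.neg, x ∉ t)

instance (X : Pattern I) (t : Finset I) : Decidable (occursIn X t) :=
  inferInstanceAs (Decidable (_ ∧ _))

/-- Occurrence list `Occ_D(X) = {t ∈ D : X ⊑ t}`. -/
def Occ (D : Finset (Finset I)) (X : Pattern I) : Finset (Finset I) :=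
  D.filter (fun t => occursIn X t)

/-- Support `Sup_D(X) = |Occ_D(X)|`. -/
def supp (D : Finset (Finset I)) (X : Pattern I) : ℕ := (Occ D X).card

/-- A literal: an item (`inl`) or a negated item (`inr`). -/
abbrev Lit (I : Type*) := I ⊕ I

/-- `P + a`: add literal `a` to pattern `P`. -/
def addLit (P : Pattern I) (a : Lit I) : Pattern I :=
  match a with
  | .inl x => ⟨insert x P.pos, P.neg⟩
  | .inr x => ⟨P.pos, insert x P.neg⟩

/-- `Z \ {a}`: remove literal `a` from pattern `Z`. -/
def removeLit (P : Pattern I) (a : Lit I) : Pattern I :=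
  match a with
  | .inl x => ⟨P.pos.erase x, P.neg⟩
  | .inr x => ⟨P.pos, P.neg.erase x⟩

/-- Literal `a` occurs in pattern `P`. -/
def litMem (a : Lit I) (P : Pattern I) : Prop :=
  match a with
  | .inl x => x ∈ P.pos
  | .inr x => x ∈ P.neg

/-- Pattern inclusion: componentwise inclusion of positive and negated parts. -/
def subPat (P Q : Pattern I) : Prop := P.pos ⊆ Q.pos ∧ P.neg ⊆ Q.neg

/-- Pattern union: componentwise union. -/
def unionPat (P Q : Pattern I) : Pattern I := ⟨P.pos ∪ Q.pos, P.neg ∪ Q.neg⟩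

/-- `MIN ℂ`: patterns in `ℂ` with no proper subset in `ℂ`. -/
def MinC (C : Set (Pattern I)) : Set (Pattern I) :=
  {X ∈ C | ∀ Y : Pattern I, subPat Y X → Y ≠ X → Y ∉ C}

/-- Condition C1'. -/
def CondC1' (Dm : Finset (Finset I)) (C : Set (Pattern I)) : Prop :=
  ∀ (P : Pattern I) (a : Lit I),
    supp Dm P = supp Dm (addLit P a) → addLit P a ∈ C → P ∈ C

/-- Condition C2'. -/
def CondC2' (Dp Dm : Finset (Finset I)) (C : Set (Pattern I)) : Prop :=
  ∀ P Q : Pattern I, Occ Dp P = Occ Dp Q → Occ Dm P = Occ Dm Q → (P ∈ C ↔ Q ∈ C)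

/-- Contrast constraint `CP[σ₊, σ₋]`. -/
def CPset (Dp Dm : Finset (Finset I)) (σp σm : ℕ) : Set (Pattern I) :=
  {X | σp ≤ supp Dp X ∧ supp Dm X ≤ σm}

/-- Growth-rate constraint `GR[θ]` (division-free form). -/
def GRset (Dp Dm : Finset (Finset I)) (θ : ℝ) : Set (Pattern I) :=
  {X | θ * (supp Dm X : ℝ) ≤ (supp Dp X : ℝ)}

/-- The literal `a` is satisfied by the tuple `t`. -/
def litHolds (a : Lit I) (t : Finset I) : Prop :=
  match a with
  | .inl x => x ∈ t
  | .inr x => x ∉ t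

omit [Fintype I] in
theorem occursIn_addLit (P : Pattern I) (a : Lit I) (t : Finset I) :
    occursIn (addLit P a) t ↔ occursIn P t ∧ litHolds a t := by
  cases a <;> simp [occursIn, addLit, litHolds] <;> tauto

omit [Fintype I] in
theorem addLit_removeLit {Z : Pattern I} {a : Lit I} (h : litMem a Z) :
    addLit (removeLit Z a) a = Z := by
  cases a <;> simp_all [addLit, removeLit, litMem, Finset.insert_erase]

omit [Fintype I] in
theorem litMem_of_subPat_addLit {P Z : Pattern I} {a : Lit I} (h : subPat (addLit P a) Z) :
    litMem a Z := by
  cases a with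
  | inl x => exact h.1 (Finset.mem_insert_self x P.pos)
  | inr x => exact h.2 (Finset.mem_insert_self x P.neg)

omit [Fintype I] in
theorem subPat_removeLit {P Z : Pattern I} {a : Lit I} (ha : ¬ litMem a P)
    (h : subPat (addLit P a) Z) : subPat P (removeLit Z a) := by
  cases a with
  | inl x => exact ⟨Finset.subset_erase.2 ⟨(Finset.subset_insert x P.pos).trans h.1, ha⟩, h.2⟩
  | inr x => exact ⟨h.1, Finset.subset_erase.2 ⟨(Finset.subset_insert x P.neg).trans h.2, ha⟩⟩

omit [Fintype I] [DecidableEq I] in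
theorem occursIn_of_subPat {P Q : Pattern I} {t : Finset I} (h : subPat P Q)
    (ht : occursIn Q t) : occursIn P t :=
  ⟨fun x hx => ht.1 x (h.1 hx), fun x hx => ht.2 x (h.2 hx)⟩

theorem Occ_addLit_subset (D : Finset (Finset I)) (P : Pattern I) (a : Lit I) :
    Occ D (addLit P a) ⊆ Occ D P :=
  Finset.monotone_filter_right D fun t _ ht => ((occursIn_addLit P a t).1 ht).1

/-- support equality propagates to all extensions. -/
theorem occ_removeLit_eq_of_sup_eq (P : Pattern I) (a : Lit I) (ha : ¬ litMem a P)
    (D : Finset (Finset I)) (h : supp D P = supp D (addLit P a)) :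
    ∀ Z : Pattern I, subPat (addLit P a) Z →
      Occ D (removeLit Z a) = Occ D Z ∧ supp D (removeLit Z a) = supp D Z := by
  intro Z hZ
  have hP : Occ D (addLit P a) = Occ D P :=
    Finset.eq_of_subset_of_card_le (Occ_addLit_subset D P a) h.le
  have hOcc : Occ D (removeLit Z a) = Occ D Z := by
    refine Finset.Subset.antisymm (fun t ht => ?_) ?_
    · obtain ⟨htD, htZ⟩ := Finset.mem_filter.1 ht
      have htP : t ∈ Occ D (addLit P a) :=
        hP ▸ Finset.mem_filter.2 ⟨htD, occursIn_of_subPat (subPat_removeLit ha hZ) htZ⟩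
      have hta := ((occursIn_addLit P a t).1 (Finset.mem_filter.1 htP).2).2
      have := (occursIn_addLit (removeLit Z a) a t).2 ⟨htZ, hta⟩
      rw [addLit_removeLit (litMem_of_subPat_addLit hZ)] at this
      exact Finset.mem_filter.2 ⟨htD, this⟩
    · have := Occ_addLit_subset D (removeLit Z a) a
      rwa [addLit_removeLit (litMem_of_subPat_addLit hZ)] at this
  exact ⟨hOcc, congrArg Finset.card hOcc⟩
end

section
/- Soundness of Pruning 3 for the growth-rate constraint (upper bound on GR over descendants): let (D_+, D_-) be a labeled database, P a pattern, and B a set of literals disjoint from P. Suppose Sup_-(P ∪ B) > 0. Then for every pattern Q with P ⊆ Q ⊆ P ∪ B and Sup_-(Q) > 0, the growth rate satisfies Sup_+(Q)/Sup_-(Q) ≤ Sup_+(P)/Sup_-(P ∪ B) (as real numbers); consequently, if Sup_+(P)/Sup_-(P ∪ B) < θ, then no pattern Q with P ⊆ Q ⊆ P ∪ B belongs to GR[θ]. -/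
variable {I : Type*} [Fintype I] [DecidableEq I]

/-- Support is antitone with respect to pattern inclusion. -/
theorem supp_le_supp_of_subPat (D : Finset (Finset I)) {X Y : Pattern I} (h : subPat X Y) :
    supp D Y ≤ supp D X :=
  Finset.card_le_card <| Finset.monotone_filter_right D fun _ _ ht =>
    ⟨fun x hx => ht.1 x (h.1 hx), fun x hx => ht.2 x (h.2 hx)⟩

/-- soundness of Pruning 3 for the growth-rate constraint
(upper bound on the growth rate over descendants). -/
theorem pruning3_sound_GR (Dp Dm : Finset (Finset I)) (θ : ℝ) (hθ : 0 ≤ θ)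
    (P B : Pattern I) (hdisj : Disjoint P.pos B.pos ∧ Disjoint P.neg B.neg)
    (hpos : 0 < supp Dm (unionPat P B)) :
    (∀ Q : Pattern I, subPat P Q → subPat Q (unionPat P B) → 0 < supp Dm Q →
      (supp Dp Q : ℝ) / (supp Dm Q : ℝ) ≤ (supp Dp P : ℝ) / (supp Dm (unionPat P B) : ℝ)) ∧
    ((supp Dp P : ℝ) / (supp Dm (unionPat P B) : ℝ) < θ →
      ∀ Q : Pattern I, subPat P Q → subPat Q (unionPat P B) →
        Q ∉ GRset Dp Dm θ) := by
  have key : ∀ Q : Pattern I, subPat P Q → subPat Q (unionPat P B) →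
      (supp Dp Q : ℝ) / (supp Dm Q : ℝ) ≤
        (supp Dp P : ℝ) / (supp Dm (unionPat P B) : ℝ) := by
    intro Q hPQ hQ
    have hp := supp_le_supp_of_subPat Dp hPQ
    have hm := supp_le_supp_of_subPat Dm hQ
    gcongr
  refine ⟨fun Q hPQ hQ _ => key Q hPQ hQ, fun hlt Q hPQ hQ hmem => ?_⟩
  have hQpos : (0 : ℝ) < supp Dm Q := by
    exact_mod_cast hpos.trans_le (supp_le_supp_of_subPat Dm hQ)
  exact (((le_div_iff₀ hQpos).mpr hmem).trans (key Q hPQ hQ)).not_gt hlt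
end
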